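/- Let d ≥ 1 be an integer and α ≥ 1. Suppose for every N there exists an N-point set P ⊂ [0,1]^d with ‖Δ_P‖_{L_d} ≤ a N^{-1/2} and ‖Δ_P‖_{L_∞} ≤ a d^{1/2} N^{-1/2}, where a = 12.75, and suppose ‖Δ_∅‖_{ψ_α} ≥ (e^{11/12}/√(2π))^{1/α} ‖Δ_∅‖_α with ‖Δ_∅‖_α ≥ (4(d log(d+1))^{1/α})^{-1} and ‖Δ_P‖_{ψ_α} ≤ (2eα)^{1/α}‖Δ_P‖_α. Then N_{ψ_α}(ε,d) ≤ ⌈C_α · d^{max{1,2/α}} (log(d+1))^{2/α} ε^{-2}⌉ with C_α = 2601 · α^{2/α} · (√(2π)/e^{11/12})^{2/α}. -/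

import Mathlib

open MeasureTheory Real
open scoped ENNReal Classical

/-- Lebesgue measure restricted to the unit cube `[0,1]^d` (a probability measure). -/
noncomputable def cubeMeasure (d : ℕ) : Measure (Fin d → ℝ) :=
  volume.restrict (Set.Icc 0 1)

/-- The local discrepancy function `Δ_P(t) = #{j : x_j ∈ [0,t)}/N - t_1⋯t_d`. -/
noncomputable def localDisc (d N : ℕ) (P : Fin N → (Fin d → ℝ)) (t : Fin d → ℝ) : ℝ :=
  (Finset.univ.filter fun j => ∀ i, P j i < t i).card / N - ∏ i, t i

/-- The norm `‖f‖_α = sup_{p ≥ 1} p^{-1/α} ‖f‖_{L_p}` on `[0,1]^d`. -/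
noncomputable def alphaNorm (d : ℕ) (α : ℝ) (f : (Fin d → ℝ) → ℝ) : ℝ≥0∞ :=
  ⨆ p : {p : ℝ // 1 ≤ p},
    ENNReal.ofReal (p.1 ^ (-(1 / α))) * eLpNorm f (ENNReal.ofReal p.1) (cubeMeasure d)

/-- The exponential Orlicz function `ψ_α(x) = exp(x^α) - 1`. -/
noncomputable def psiAlpha (α x : ℝ) : ℝ := Real.exp (x ^ α) - 1

/-- The Luxemburg (quasi-)norm on `[0,1]^d` associated with an Orlicz function `ψ`,
with value `∞` if no admissible constant `K` exists. -/
noncomputable def luxNorm (d : ℕ) (ψ : ℝ → ℝ) (f : (Fin d → ℝ) → ℝ) : ℝ≥0∞ :=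
  sInf {K : ℝ≥0∞ | 0 < K ∧ K ≠ ⊤ ∧
    ∫⁻ x, ENNReal.ofReal (ψ (|f x| / K.toReal)) ∂(cubeMeasure d) ≤ 1}

/-- The `N`-th minimal `ψ_α`-discrepancy over `N`-point sets in the cube. -/
noncomputable def discPsiAlpha (d : ℕ) (α : ℝ) (N : ℕ) : ℝ≥0∞ :=
  ⨅ P : {P : Fin N → (Fin d → ℝ) // ∀ j, P j ∈ Set.Icc 0 1},
    luxNorm d (psiAlpha α) (localDisc d N P.1)

/-- The initial `ψ_α`-discrepancy `‖Δ_∅‖_{ψ_α}` in dimension `d`. -/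
noncomputable def initDiscPsiAlpha (d : ℕ) (α : ℝ) : ℝ≥0∞ :=
  luxNorm d (psiAlpha α) (fun t => -∏ i, t i)

/-- `N_{ψ_α}(ε,d) = min{N : disc_{ψ_α}(N,d) ≤ ε ‖Δ_∅‖_{ψ_α}}`. -/
noncomputable def invNPsiAlpha (d : ℕ) (α : ℝ) (ε : ℝ) : ℕ :=
  sInf {N : ℕ | discPsiAlpha d α N ≤ ENNReal.ofReal ε * initDiscPsiAlpha d α}

lemma aux_exponent (α : ℝ) (hα : 1 ≤ α) (D : ℝ) (hd : 1 ≤ D) (f : ℝ) (hf : 0 ≤ f)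
    (hfd : f ≤ D ^ ((1 : ℝ) / 2)) :
    (f ≤ 2 → (f / (2 * α ^ (1 / α) * D ^ (max (1 / 2) (1 / α) - 1 / α))) ^ α ≤ f / 2) ∧
    (2 ≤ f → (f / (2 * α ^ (1 / α) * D ^ (max (1 / 2) (1 / α) - 1 / α))) ^ α ≤ D / 4) := by
  have hα0 : 0 < α := by linarith
  have hD0 : 0 < D := by linarith
  have hf2 : f ^ 2 ≤ D := by
    have : (D ^ ((1 : ℝ) / 2)) ^ 2 = D := by
      rw [← Real.rpow_natCast, ← Real.rpow_mul hD0.le]; norm_num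
    rw [← this]; gcongr
  obtain ⟨x, hx⟩ : ∃ x, x = f / 2 := ⟨_, rfl⟩
  have hx0 : 0 ≤ x := by rw [hx]; positivity
  have hE : (f / (2 * α ^ (1 / α) * D ^ (max (1 / 2) (1 / α) - 1 / α))) ^ α
      = x ^ α / (α * D ^ ((max (1 / 2) (1 / α) - 1 / α) * α)) := by
    rw [show f / (2 * α ^ (1 / α) * D ^ (max (1 / 2) (1 / α) - 1 / α))
        = x / (α ^ (1 / α) * D ^ (max (1 / 2) (1 / α) - 1 / α)) by rw [hx]; field_simp]
    rw [Real.div_rpow hx0 (by positivity), Real.mul_rpow (by positivity) (by positivity),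
      ← Real.rpow_mul hα0.le, ← Real.rpow_mul hD0.le]
    rw [one_div_mul_cancel hα0.ne', Real.rpow_one]
  rw [hE]
  rcases le_total α 2 with h2 | h2
  · have hm : max (1 / 2 : ℝ) (1 / α) = 1 / α := by
      apply max_eq_right
      exact one_div_le_one_div_of_le hα0 h2
    rw [hm]; simp only [sub_self, zero_mul, Real.rpow_zero, mul_one]
    have h1 : x ^ α / α ≤ x ^ α := div_le_self (by positivity) hα
    refine ⟨fun h => ?_, fun h => ?_⟩
    · have : x ^ α ≤ x := Real.rpow_le_self_of_le_one hx0 (by linarith) hα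
      linarith
    · have : x ^ α ≤ x ^ (2 : ℝ) := Real.rpow_le_rpow_of_exponent_le (by linarith) h2
      rw [Real.rpow_two] at this
      rw [hx] at this h1 ⊢
      nlinarith
  · have hm : max (1 / 2 : ℝ) (1 / α) = 1 / 2 := by
      apply max_eq_left
      exact one_div_le_one_div_of_le (by norm_num) h2
    rw [hm]
    have he : (1 / 2 - 1 / α) * α = 1 / 2 * (α - 2) := by field_simp
    rw [he]
    have hxα : x ^ α ≤ x ^ 2 * D ^ (1 / 2 * (α - 2)) := by
      have : x ^ α = x ^ 2 * x ^ (α - 2) := by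
        rw [← Real.rpow_two, ← Real.rpow_add_of_nonneg hx0 (by norm_num) (by linarith)]
        congr 1; ring
      rw [this, Real.rpow_mul hD0.le]
      gcongr
      · linarith
    have h1 : x ^ α / (α * D ^ (1 / 2 * (α - 2))) ≤ x ^ 2 := by
      rw [div_le_iff₀ (by positivity)]
      have : 0 ≤ x ^ 2 * D ^ (1 / 2 * (α - 2)) := by positivity
      nlinarith
    refine ⟨fun h => ?_, fun h => ?_⟩
    · rw [← hx]; nlinarith
    · rw [hx] at h1 ⊢; nlinarith

lemma aux_exp_half : Real.exp (1 / 2) ≤ 1.65 := by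
  have h : Real.exp (1 / 2) ^ 2 = Real.exp 1 := by
    rw [← Real.exp_nat_mul]; norm_num
  have := Real.exp_one_lt_d9
  by_contra! hc
  nlinarith

lemma aux_exp_quarter : Real.exp (1 / 4) ≤ 1.3 := by
  have h : Real.exp (1 / 4) ^ 2 = Real.exp (1 / 2) := by
    rw [← Real.exp_nat_mul]; norm_num
  have := aux_exp_half
  by_contra! hc
  nlinarith

lemma aux_pointwise (α : ℝ) (hα : 1 ≤ α) (d : ℕ) (hd : 1 ≤ d) (f : ℝ) (hf : 0 ≤ f)
    (hfd : f ≤ (d : ℝ) ^ ((1 : ℝ) / 2)) :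
    psiAlpha α (f / (2 * α ^ (1 / α) * (d : ℝ) ^ (max (1 / 2) (1 / α) - 1 / α)))
      ≤ 0.65 + 0.35 * f ^ d := by
  have hd1 : (1 : ℝ) ≤ d := by exact_mod_cast hd
  have hD0 : (0 : ℝ) < d := by linarith
  obtain ⟨hA, hB⟩ := aux_exponent α hα d hd1 f hf hfd
  have hf2 : f ^ 2 ≤ d := by
    have : ((d : ℝ) ^ ((1 : ℝ) / 2)) ^ 2 = d := by
      rw [← Real.rpow_natCast, ← Real.rpow_mul hD0.le]; norm_num
    rw [← this]; gcongr
  unfold psiAlpha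
  rcases le_total f 2 with h2 | h2
  · have h := Real.exp_le_exp.2 (hA h2)
    rcases le_total f 1 with h1 | h1
    · have : Real.exp (f / 2) ≤ Real.exp (1 / 2) := Real.exp_le_exp.2 (by linarith)
      have := aux_exp_half
      have : 0 ≤ f ^ d := by positivity
      linarith
    · rcases h1.eq_or_lt with h1 | h1
      · have : Real.exp (f / 2) ≤ Real.exp (1 / 2) := Real.exp_le_exp.2 (by linarith)
        have := aux_exp_half
        have : 0 ≤ f ^ d := by positivity
        linarith
      have hd2 : 2 ≤ d := by
        have : (1 : ℝ) < d := by nlinarith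
        exact_mod_cast this
      have hp : f ^ 2 ≤ f ^ d := pow_le_pow_right₀ h1.le hd2
      have hc := convexOn_exp.2 (Set.mem_univ (1 / 2 : ℝ)) (Set.mem_univ (1 : ℝ))
        (show 0 ≤ 2 - f by linarith) (show 0 ≤ f - 1 by linarith) (by ring)
      simp only [smul_eq_mul] at hc
      rw [show (2 - f) * (1 / 2) + (f - 1) * 1 = f / 2 by ring] at hc
      have := Real.exp_one_lt_d9
      have := aux_exp_half
      nlinarith [sq_nonneg (f - 1.5)]
  · have h := Real.exp_le_exp.2 (hB h2)
    have hd4 : 4 ≤ d := by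
      have : (4 : ℝ) ≤ d := by nlinarith
      exact_mod_cast this
    have h3 : Real.exp ((d : ℝ) / 4) ≤ 1.3 ^ d := by
      rw [show (d : ℝ) / 4 = d * (1 / 4) by ring, Real.exp_nat_mul]
      have := aux_exp_quarter
      gcongr
    have h4 : (2 : ℝ) ^ d ≤ f ^ d := by gcongr
    have h5 : (1.3 : ℝ) ^ d ≤ 0.35 * 2 ^ d := by
      obtain ⟨n, rfl⟩ := Nat.exists_eq_add_of_le hd4
      rw [pow_add, pow_add]
      have : (1.3 : ℝ) ^ n ≤ 2 ^ n := by gcongr; norm_num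
      have : (0 : ℝ) < 2 ^ n := by positivity
      have e1 : (1.3 : ℝ) ^ 4 ≤ 0.35 * 2 ^ 4 := by norm_num
      nlinarith
    linarith

lemma aux_lux_upper (α : ℝ) (hα : 1 ≤ α) (d : ℕ) (hd : 1 ≤ d) (g : (Fin d → ℝ) → ℝ)
    (m : ℝ) (hm : 0 < m)
    (h1 : eLpNorm g (ENNReal.ofReal d) (cubeMeasure d) ≤ ENNReal.ofReal m)
    (h2 : eLpNorm g ⊤ (cubeMeasure d) ≤ ENNReal.ofReal (m * (d : ℝ) ^ ((1 : ℝ) / 2))) :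
    luxNorm d (psiAlpha α) g ≤ ENNReal.ofReal
      (m * (2 * α ^ (1 / α) * (d : ℝ) ^ (max (1 / 2) (1 / α) - 1 / α))) := by
  have hα0 : 0 < α := by linarith
  have hd1 : (1 : ℝ) ≤ d := by exact_mod_cast hd
  have hD0 : (0 : ℝ) < d := by linarith
  set c := 2 * α ^ (1 / α) * (d : ℝ) ^ (max (1 / 2) (1 / α) - 1 / α) with hc
  have hc0 : 0 < c := by positivity
  apply sInf_le
  refine ⟨by simp; positivity, by simp, ?_⟩
  rw [ENNReal.toReal_ofReal (by positivity)]
  have hvol : cubeMeasure d Set.univ = 1 := by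
    simp [cubeMeasure, Real.volume_Icc_pi]
  -- the moment bound
  have hmom : ∫⁻ x, ‖g x‖ₑ ^ d ∂(cubeMeasure d) ≤ ENNReal.ofReal m ^ d := by
    rw [eLpNorm_eq_lintegral_rpow_enorm_toReal (by simp; omega) (by simp),
      ENNReal.toReal_ofReal hD0.le] at h1
    have := ENNReal.rpow_le_rpow h1 hD0.le
    rw [← ENNReal.rpow_mul, one_div_mul_cancel hD0.ne', ENNReal.rpow_one] at this
    simpa using this
  have hae : ∀ᵐ x ∂(cubeMeasure d), |g x| ≤ m * (d : ℝ) ^ ((1 : ℝ) / 2) := by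
    rw [eLpNorm_exponent_top] at h2
    filter_upwards [ae_le_eLpNormEssSup (f := g) (μ := cubeMeasure d)] with x hx
    have := hx.trans h2
    rw [Real.enorm_eq_ofReal_abs] at this
    exact (ENNReal.ofReal_le_ofReal_iff (by positivity)).1 this
  calc ∫⁻ x, ENNReal.ofReal (psiAlpha α (|g x| / (m * c))) ∂(cubeMeasure d)
      ≤ ∫⁻ x, (ENNReal.ofReal 0.65 + ENNReal.ofReal (0.35 / m ^ d) * ‖g x‖ₑ ^ d)
          ∂(cubeMeasure d) := by
        apply lintegral_mono_ae
        filter_upwards [hae] with x hx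
        have := aux_pointwise α hα d hd (|g x| / m) (by positivity)
          (by rw [div_le_iff₀ hm]; linarith)
        rw [← hc, div_div] at this
        rw [Real.enorm_eq_ofReal_abs, ← ENNReal.ofReal_pow (abs_nonneg _),
          ← ENNReal.ofReal_mul (by positivity), ← ENNReal.ofReal_add (by norm_num) (by positivity)]
        apply ENNReal.ofReal_le_ofReal
        refine this.trans (le_of_eq ?_)
        rw [div_pow]; ring
    _ = ENNReal.ofReal 0.65 + ENNReal.ofReal (0.35 / m ^ d) *
          ∫⁻ x, ‖g x‖ₑ ^ d ∂(cubeMeasure d) := by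
        rw [lintegral_add_left measurable_const, lintegral_const_mul' _ _ (by simp),
          lintegral_const, hvol, mul_one]
    _ ≤ ENNReal.ofReal 0.65 + ENNReal.ofReal (0.35 / m ^ d) * ENNReal.ofReal m ^ d := by
        gcongr
    _ = 1 := by
        rw [← ENNReal.ofReal_pow hm.le, ← ENNReal.ofReal_mul (by positivity),
          ← ENNReal.ofReal_add (by norm_num) (by positivity), div_mul_cancel₀ _ (by positivity)]
        norm_num

lemma aux_psi_convex (α : ℝ) (hα : 1 ≤ α) : ConvexOn ℝ (Set.Ici 0) (psiAlpha α) := by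
  have h : ConvexOn ℝ (Set.Ici 0) (Real.exp ∘ fun x : ℝ => x ^ α) := by
    apply ConvexOn.comp _ (convexOn_rpow hα) (Real.exp_monotone.monotoneOn _)
    refine convexOn_exp.subset (Set.subset_univ _) ?_
    apply Set.OrdConnected.convex
    have : (fun x : ℝ => x ^ α) '' Set.Ici 0 = Set.Ici 0 := by
      ext y; constructor
      · rintro ⟨x, hx, rfl⟩; exact Real.rpow_nonneg hx _
      · intro hy
        refine ⟨y ^ α⁻¹, Real.rpow_nonneg hy _, ?_⟩
        exact Real.rpow_inv_rpow hy (by linarith)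
    rw [this]; exact Set.ordConnected_Ici
  have := h.add_const (-1)
  refine this.congr fun x _ => ?_
  simp [psiAlpha, sub_eq_add_neg]

lemma aux_init_lower (α : ℝ) (hα : 1 ≤ α) (d : ℕ) (hd : 1 ≤ d) (k : ℝ) (hk : 0 < k)
    (h : ∫⁻ x, ENNReal.ofReal (psiAlpha α (|-∏ i, x i| / k)) ∂(cubeMeasure d) ≤ 1) :
    (1 / (2 * k)) ^ α ≤ d * Real.log (d + 1) := by
  have hα0 : 0 < α := by linarith
  have hd1 : (1 : ℝ) ≤ d := by exact_mod_cast hd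
  have hD0 : (0 : ℝ) < d := by linarith
  have hδ1 : 1 / (d : ℝ) ≤ 1 := by rw [div_le_one hD0]; exact hd1
  have hδ0 : 0 < 1 / (d : ℝ) := by positivity
  set Q : Set (Fin d → ℝ) := Set.Icc (fun _ => 1 - 1 / (d : ℝ)) (fun _ => 1) with hQ
  have hQs : Q ⊆ Set.Icc 0 1 := by
    intro t ht
    exact ⟨fun i => by have := ht.1 i; simp at this ⊢; simp at hδ1; linarith, fun i => ht.2 i⟩
  have hQle : (fun _ : Fin d => 1 - 1 / (d : ℝ)) ≤ (fun _ => 1) := fun i => by simp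
  have hvr : volume.real Q = (1 / (d : ℝ)) ^ d := by
    rw [Measure.real, hQ, Real.volume_Icc_pi_toReal hQle]; simp
  have hvr0 : 0 < volume.real Q := by rw [hvr]; positivity
  have hQ0 : volume Q ≠ 0 := by
    intro h0; rw [Measure.real, h0] at hvr0; simp at hvr0
  have hQt : volume Q ≠ ⊤ := by
    intro h0; rw [Measure.real, h0] at hvr0; simp at hvr0
  have hQc : IsCompact Q := isCompact_Icc
  have hψc : Continuous (psiAlpha α) := by
    unfold psiAlpha
    exact (Real.continuous_exp.comp (Real.continuous_rpow_const hα0.le)).sub continuous_const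
  have hfc : Continuous fun t : Fin d → ℝ => |-∏ i, t i| / k := by fun_prop
  have hψ0 : ∀ x, 0 ≤ x → 0 ≤ psiAlpha α x := fun x hx => by
    unfold psiAlpha
    have := Real.one_le_exp (Real.rpow_nonneg hx α)
    linarith
  have hint : IntegrableOn (psiAlpha α ∘ fun t : Fin d → ℝ => |-∏ i, t i| / k) Q volume :=
    (hψc.comp hfc).continuousOn.integrableOn_compact hQc
  have hJ := (aux_psi_convex α hα).map_set_average_le hψc.continuousOn isClosed_Ici hQ0 hQt
    (f := fun t : Fin d → ℝ => |-∏ i, t i| / k)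
    (Filter.Eventually.of_forall fun x => by simp only [Set.mem_Ici]; positivity)
    (hfc.continuousOn.integrableOn_compact hQc) hint
  rw [setAverage_eq, setAverage_eq, hvr] at hJ
  have hI1 : ∫ x in Q, psiAlpha α (|-∏ i, x i| / k) ≤ 1 := by
    have h1 := ofReal_integral_eq_lintegral_ofReal hint
      (Filter.Eventually.of_forall fun x => hψ0 _ (by positivity))
    have h2 : ∫⁻ x in Q, ENNReal.ofReal (psiAlpha α (|-∏ i, x i| / k)) ≤ 1 := by
      refine le_trans ?_ h
      exact lintegral_mono' (Measure.restrict_mono hQs le_rfl) le_rfl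
    simp only [Function.comp_apply] at h1
    rw [← h1] at h2
    simpa using h2
  have hI2 : ∫ x in Q, |-∏ i, x i| / k = ((1 / (d : ℝ)) * (1 - 1 / (2 * d))) ^ d / k := by
    have e1 : ∫ x in Q, |-∏ i, x i| / k = ∫ x in Q, (∏ i, x i) / k := by
      apply setIntegral_congr_fun measurableSet_Icc
      intro t ht
      simp only [abs_neg]
      rw [abs_of_nonneg (Finset.prod_nonneg fun i _ => (hQs ht).1 i)]
    rw [e1, integral_div, hQ, ← Set.pi_univ_Icc, volume_pi, Measure.restrict_pi_pi,
      integral_fintype_prod_eq_prod (fun _ x => x)]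
    congr 1
    rw [Finset.prod_const, Finset.card_univ, Fintype.card_fin]
    congr 1
    rw [integral_Icc_eq_integral_Ioc, ← intervalIntegral.integral_of_le (by linarith),
      integral_id]
    field_simp
    ring
  rw [hI2] at hJ
  simp only [smul_eq_mul] at hJ
  have hx0 : ((1 / (d : ℝ)) ^ d)⁻¹ * (((1 / (d : ℝ)) * (1 - 1 / (2 * d))) ^ d / k)
      = (1 - 1 / (2 * (d : ℝ))) ^ d / k := by
    rw [mul_pow, mul_div_assoc, inv_mul_cancel_left₀ (by positivity)]
  rw [hx0] at hJ
  have hb : 1 / 2 ≤ (1 - 1 / (2 * (d : ℝ))) ^ d := by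
    have hh : 1 / (2 * (d : ℝ)) ≤ 1 := by
      rw [div_le_one (by positivity)]; linarith
    have := one_add_mul_le_pow (a := -(1 / (2 * (d : ℝ)))) (by linarith) d
    rw [← sub_eq_add_neg] at this
    refine le_trans (le_of_eq ?_) this
    field_simp; norm_num
  have hb2 : 1 / (2 * k) ≤ (1 - 1 / (2 * (d : ℝ))) ^ d / k := by
    rw [← div_div]; gcongr
  have hb3 : (1 / (2 * k)) ^ α ≤ ((1 - 1 / (2 * (d : ℝ))) ^ d / k) ^ α := by gcongr
  refine hb3.trans ?_
  have h5 : Real.exp (((1 - 1 / (2 * (d : ℝ))) ^ d / k) ^ α) ≤ ((d : ℝ) + 1) ^ d := by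
    have : ((1 / (d : ℝ)) ^ d)⁻¹ * ∫ x in Q, psiAlpha α (|-∏ i, x i| / k) ≤ (d : ℝ) ^ d := by
      rw [show ((1 / (d : ℝ)) ^ d)⁻¹ = (d : ℝ) ^ d by rw [one_div, inv_pow, inv_inv]]
      exact mul_le_of_le_one_right (by positivity) hI1
    have h6 := hJ.trans this
    have h7 : (d : ℝ) ^ d + 1 ^ d ≤ ((d : ℝ) + 1) ^ d :=
      pow_add_pow_le hD0.le zero_le_one (by omega)
    unfold psiAlpha at h6
    rw [one_pow] at h7
    linarith
  have h8 := (Real.le_log_iff_exp_le (by positivity)).2 h5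
  rwa [Real.log_pow] at h8

lemma aux_init (α : ℝ) (hα : 1 ≤ α) (d : ℕ) (hd : 1 ≤ d) :
    ENNReal.ofReal (1 / (2 * ((d : ℝ) * Real.log (d + 1)) ^ (1 / α))) ≤ initDiscPsiAlpha d α := by
  have hα0 : 0 < α := by linarith
  have hd1 : (1 : ℝ) ≤ d := by exact_mod_cast hd
  have hL : 0 < Real.log ((d : ℝ) + 1) := Real.log_pos (by linarith)
  have hY : 0 < ((d : ℝ) * Real.log (d + 1)) ^ (1 / α) := by positivity
  apply le_sInf
  rintro K ⟨hK0, hKt, hK⟩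
  have hk : 0 < K.toReal := ENNReal.toReal_pos hK0.ne' hKt
  have h := aux_init_lower α hα d hd K.toReal hk hK
  apply ENNReal.ofReal_le_of_le_toReal
  have h1 := Real.rpow_le_rpow (by positivity) h (show 0 ≤ 1 / α by positivity)
  rw [← Real.rpow_mul (by positivity), mul_one_div_cancel hα0.ne', Real.rpow_one] at h1
  rw [div_le_iff₀ (by positivity)] at h1 ⊢
  nlinarith

lemma aux_B : 1 ≤ Real.sqrt (2 * π) / Real.exp (11 / 12) := by
  rw [one_le_div (Real.exp_pos _)]
  apply Real.le_sqrt_of_sq_le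
  have h1 : Real.exp (11 / 12) ^ 12 = Real.exp 1 ^ 11 := by
    rw [← Real.exp_nat_mul, ← Real.exp_nat_mul]; norm_num
  have h2 : Real.exp 1 ^ 11 ≤ 2.7182818286 ^ 11 := by
    have := Real.exp_one_lt_d9
    gcongr
  have h3 := Real.pi_gt_d2
  have h4 : (Real.exp (11 / 12) ^ 2) ^ 6 ≤ (6.28 : ℝ) ^ 6 := by
    rw [← pow_mul]; norm_num1 
    rw [h1]; refine h2.trans ?_; norm_num
  have h5 := (pow_le_pow_iff_left₀ (by positivity) (by norm_num) (by norm_num)).1 h4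
  linarith

/-- Let `α ≥ 1`, `d ≥ 1`, `a = 12.75`.  Suppose for every `N ≥ 1` there is
an `N`-point set `P ⊆ [0,1]^d` with `‖Δ_P‖_{L_d} ≤ a N^{-1/2}` and
`‖Δ_P‖_{L_∞} ≤ a d^{1/2} N^{-1/2}`; suppose moreover
`‖Δ_∅‖_{ψ_α} ≥ (e^{11/12}/√(2π))^{1/α} ‖Δ_∅‖_α` with `‖Δ_∅‖_α ≥ (4 (d log(d+1))^{1/α})⁻¹`,
and `‖Δ_P‖_{ψ_α} ≤ (2eα)^{1/α} ‖Δ_P‖_α` for every point set `P`.  Then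
`N_{ψ_α}(ε,d) ≤ ⌈C_α d^{max{1,2/α}} (log(d+1))^{2/α} ε^{-2}⌉` with
`C_α = 2601 α^{2/α} (√(2π)/e^{11/12})^{2/α}`. -/
theorem invNPsiAlpha_upper_bound (α : ℝ) (hα : 1 ≤ α) (d : ℕ) (hd : 1 ≤ d)
    (hP : ∀ N : ℕ, 1 ≤ N → ∃ P : Fin N → (Fin d → ℝ),
      (∀ j, P j ∈ Set.Icc 0 1) ∧
      eLpNorm (localDisc d N P) (ENNReal.ofReal d) (cubeMeasure d) ≤
        ENNReal.ofReal (12.75 * (N : ℝ) ^ (-(1 / 2 : ℝ))) ∧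
      eLpNorm (localDisc d N P) ⊤ (cubeMeasure d) ≤
        ENNReal.ofReal (12.75 * (d : ℝ) ^ ((1 : ℝ) / 2) * (N : ℝ) ^ (-(1 / 2 : ℝ))))
    (hlow : ENNReal.ofReal ((Real.exp (11 / 12) / Real.sqrt (2 * π)) ^ (1 / α)) *
        alphaNorm d α (fun t => -∏ i, t i) ≤ initDiscPsiAlpha d α)
    (hinit : ENNReal.ofReal ((4 * ((d : ℝ) * Real.log (d + 1)) ^ (1 / α))⁻¹) ≤
        alphaNorm d α (fun t => -∏ i, t i))
    (hup : ∀ N : ℕ, ∀ P : Fin N → (Fin d → ℝ), (∀ j, P j ∈ Set.Icc 0 1) →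
      luxNorm d (psiAlpha α) (localDisc d N P) ≤
        ENNReal.ofReal ((2 * Real.exp 1 * α) ^ (1 / α)) * alphaNorm d α (localDisc d N P)) :
    ∀ ε ∈ Set.Ioo (0 : ℝ) 1,
      invNPsiAlpha d α ε ≤
        ⌈2601 * α ^ (2 / α) * (Real.sqrt (2 * π) / Real.exp (11 / 12)) ^ (2 / α) *
          (d : ℝ) ^ max 1 (2 / α) * Real.log (d + 1) ^ (2 / α) * ε⁻¹ ^ 2⌉₊ := by
  intro ε hε
  obtain ⟨hε0, hε1⟩ := hε
  have hα0 : 0 < α := by linarith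
  have hd1 : (1 : ℝ) ≤ d := by exact_mod_cast hd
  have hD0 : (0 : ℝ) < d := by linarith
  have hL : 0 < Real.log ((d : ℝ) + 1) := Real.log_pos (by linarith)
  have hB := aux_B
  generalize Real.sqrt (2 * π) / Real.exp (11 / 12) = B at hB ⊢
  have hB0 : 0 < B := by linarith
  -- the square root of the bound, up to the factor `51`
  obtain ⟨X, hX⟩ : ∃ X, X = α ^ (1 / α) * (d : ℝ) ^ (max (1 / 2) (1 / α)) *
      Real.log (d + 1) ^ (1 / α) * ε⁻¹ := ⟨_, rfl⟩
  have hX0 : 0 < X := by rw [hX]; positivity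
  have hsq : ∀ y : ℝ, 0 < y → ∀ z : ℝ, (y ^ z) ^ 2 = y ^ (2 * z) := fun y hy z => by
    rw [← Real.rpow_natCast, ← Real.rpow_mul hy.le, mul_comm]; norm_num
  have hmax : 2 * max (1 / 2 : ℝ) (1 / α) = max 1 (2 / α) := by
    rw [mul_max_of_nonneg _ _ (by norm_num : (0 : ℝ) ≤ 2)]; congr 1 <;> ring
  have hXsq : X ^ 2 = α ^ (2 / α) * (d : ℝ) ^ max 1 (2 / α) *
      Real.log (d + 1) ^ (2 / α) * ε⁻¹ ^ 2 := by
    rw [hX, mul_pow, mul_pow, mul_pow, hsq _ hα0, hsq _ hD0, hsq _ hL, hmax, mul_one_div]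
  obtain ⟨T, hT⟩ : ∃ T, T = 2601 * α ^ (2 / α) * B ^ (2 / α) *
          (d : ℝ) ^ max 1 (2 / α) * Real.log (d + 1) ^ (2 / α) * ε⁻¹ ^ 2 := ⟨_, rfl⟩
  have hTX : (51 * X) ^ 2 ≤ T := by
    have e : T = B ^ (2 / α) * (2601 * X ^ 2) := by rw [hT, hXsq]; ring
    have hb : 1 ≤ B ^ (2 / α) := Real.one_le_rpow hB (by positivity)
    rw [e, mul_pow]
    norm_num1
    exact le_mul_of_one_le_left (by positivity) hb
  rw [← hT]
  apply Nat.sInf_le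
  have hT0 : 0 < T := lt_of_lt_of_le (by positivity) hTX
  obtain ⟨N, hN⟩ : ∃ N, N = ⌈T⌉₊ := ⟨_, rfl⟩
  have hN1 : 1 ≤ N := hN ▸ Nat.ceil_pos.2 hT0
  have hNT : T ≤ (N : ℝ) := hN ▸ Nat.le_ceil T
  rw [← hN]
  have hN0 : (0 : ℝ) < N := by exact_mod_cast hN1
  obtain ⟨P, hPc, hP1, hP2⟩ := hP N hN1
  have hm : 0 < 12.75 * (N : ℝ) ^ (-(1 / 2 : ℝ)) := by positivity
  have hup' := aux_lux_upper α hα d hd (localDisc d N P) _ hm hP1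
    (hP2.trans (le_of_eq (by congr 1; ring)))
  have hlow' := aux_init α hα d hd
  show discPsiAlpha d α N ≤ _
  have hdisc : discPsiAlpha d α N ≤ luxNorm d (psiAlpha α) (localDisc d N P) := by
    unfold discPsiAlpha
    exact iInf_le (fun P : {P : Fin N → (Fin d → ℝ) // ∀ j, P j ∈ Set.Icc 0 1} =>
      luxNorm d (psiAlpha α) (localDisc d N P.1)) ⟨P, hPc⟩
  have hmul : ENNReal.ofReal ε *
      ENNReal.ofReal (1 / (2 * ((d : ℝ) * Real.log (d + 1)) ^ (1 / α)))
      ≤ ENNReal.ofReal ε * initDiscPsiAlpha d α := by gcongr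
  refine hdisc.trans (hup'.trans (le_trans ?_ hmul))
  rw [← ENNReal.ofReal_mul hε0.le]
  apply ENNReal.ofReal_le_ofReal
  have hmX : 12.75 * (N : ℝ) ^ (-(1 / 2 : ℝ)) ≤ 1 / (4 * X) := by
    rw [Real.rpow_neg hN0.le, ← Real.sqrt_eq_rpow]
    have hs : 51 * X ≤ Real.sqrt N := Real.le_sqrt_of_sq_le (hTX.trans hNT)
    have hs0 : 0 < Real.sqrt N := Real.sqrt_pos.2 hN0
    rw [← div_eq_mul_inv, div_le_div_iff₀ hs0 (by positivity)]
    linarith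
  refine (mul_le_mul_of_nonneg_right hmX (by positivity)).trans (le_of_eq ?_)
  rw [hX, Real.rpow_sub hD0, Real.mul_rpow hD0.le hL.le]
  field_simp
  norm_num
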